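/- arXiv:1203.4972 — 3 statements merged into one kernel-verified Lean document; each statement's English description precedes it below -/
import Mathlib

section
/- Let f be a binary form of degree n = 2t or n = 2t+1. Then the length of f (the minimum length over all generalized additive decompositions of f) is at most t+1. -/
open MvPolynomial

noncomputable def contractOp (φ f : MvPolynomial (Fin 2) ℂ) : MvPolynomial (Fin 2) ℂ :=
  φ.support.sum fun m =>
    φ.coeff m • ((fun p => pderiv (0 : Fin 2) p)^[m 0]
      ((fun p => pderiv (1 : Fin 2) p)^[m 1] f))

def IsLinearForm (L : MvPolynomial (Fin 2) ℂ) : Prop := L ≠ 0 ∧ L.IsHomogeneous 1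

def Proportional (L L' : MvPolynomial (Fin 2) ℂ) : Prop := ∃ c : ℂ, L' = c • L

def IsGAD (n : ℕ) (f : MvPolynomial (Fin 2) ℂ) (m : ℕ)
    (L : Fin m → MvPolynomial (Fin 2) ℂ) (g : Fin m → ℕ)
    (G : Fin m → MvPolynomial (Fin 2) ℂ) : Prop :=
  (∀ i, IsLinearForm (L i)) ∧
  (∀ i j, i ≠ j → ¬ Proportional (L i) (L j)) ∧
  (∀ i, 1 ≤ g i) ∧
  (∀ i, (G i).IsHomogeneous (g i - 1)) ∧
  f = ∑ i, G i * (L i) ^ (n - g i + 1)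

def HasGADLength (n : ℕ) (f : MvPolynomial (Fin 2) ℂ) (s : ℕ) : Prop :=
  ∃ m L g G, IsGAD n f m L g G ∧ ∑ i, g i = s

/-- The linear form attached to a point of the projective line `ℂ ∪ {∞}`. -/
noncomputable def pointForm : Option ℂ → MvPolynomial (Fin 2) ℂ
  | none => X 0
  | some s => X 1 + C s * X 0

lemma coeff_zero_pointForm_some (s : ℂ) :
    (pointForm (some s)).coeff (Finsupp.single 0 1) = s := by
  simp [pointForm, coeff_X, coeff_C_mul, Finsupp.single_left_inj]

lemma coeff_one_pointForm_some (s : ℂ) :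
    (pointForm (some s)).coeff (Finsupp.single 1 1) = 1 := by
  simp [pointForm, coeff_X, coeff_C_mul, Finsupp.single_left_inj]

lemma coeff_zero_pointForm_none :
    (pointForm none).coeff (Finsupp.single 0 1) = 1 := by
  simp [pointForm]

lemma coeff_one_pointForm_none :
    (pointForm none).coeff (Finsupp.single 1 1) = 0 := by
  simp [pointForm, coeff_X, Finsupp.single_left_inj]

lemma isLinearForm_pointForm (o : Option ℂ) : IsLinearForm (pointForm o) := by
  cases o with
  | none => exact ⟨X_ne_zero _, isHomogeneous_X _ _⟩
  | some s =>
    refine ⟨fun h => ?_, (isHomogeneous_X _ _).add (isHomogeneous_C_mul_X _ _)⟩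
    simpa [h] using coeff_one_pointForm_some s

lemma not_proportional_pointForm {o o' : Option ℂ} (h : o ≠ o') :
    ¬ Proportional (pointForm o) (pointForm o') := by
  rintro ⟨c, hc⟩
  have h0 := congrArg (coeff (Finsupp.single 0 1)) hc
  have h1 := congrArg (coeff (Finsupp.single 1 1)) hc
  rw [coeff_smul, smul_eq_mul] at h0 h1
  rcases o with _ | s <;> rcases o' with _ | s' <;>
    simp only [coeff_zero_pointForm_some, coeff_one_pointForm_some, coeff_zero_pointForm_none,
      coeff_one_pointForm_none] at h0 h1
  · exact h rfl
  · simp at h1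
  · rw [mul_one] at h1
    rw [← h1, zero_mul] at h0
    exact one_ne_zero h0
  · rw [mul_one] at h1
    rw [← h1, one_mul] at h0
    exact h (congrArg some h0.symm)

/-- The forms `G * L ^ (n - g + 1)` with `G` homogeneous of degree `g - 1`. -/
noncomputable def gadSummands (n : ℕ) (L : MvPolynomial (Fin 2) ℂ) (g : ℕ) :
    Submodule ℂ (MvPolynomial (Fin 2) ℂ) :=
  (homogeneousSubmodule (Fin 2) ℂ (g - 1)).map (LinearMap.mulRight ℂ (L ^ (n - g + 1)))

lemma mul_mem_gadSummands {n g : ℕ} {L G : MvPolynomial (Fin 2) ℂ}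
    (hG : G.IsHomogeneous (g - 1)) : G * L ^ (n - g + 1) ∈ gadSummands n L g :=
  ⟨G, hG, rfl⟩

open Classical in
lemma hasGADLength_card_of_mem_iSup {n : ℕ} {f : MvPolynomial (Fin 2) ℂ}
    (M : Multiset (Option ℂ))
    (hf : f ∈ ⨆ o ∈ M.toFinset, gadSummands n (pointForm o) (M.count o)) :
    HasGADLength n f M.card := by
  obtain ⟨μ, rfl⟩ := (Submodule.mem_iSup_finset_iff_exists_sum _ _).1 hf
  choose G hG hμ using fun o => (μ o).2
  let e := M.toFinset.equivFin.symm
  refine ⟨M.toFinset.card, fun i => pointForm (e i), fun i => M.count (e i : Option ℂ),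
    fun i => G (e i), ⟨fun i => isLinearForm_pointForm _, fun i j hij =>
    not_proportional_pointForm fun h => hij (e.injective (Subtype.ext h)),
    fun i => Multiset.one_le_count_iff_mem.2 (Multiset.mem_toFinset.1 (e i).2),
    fun i => hG _, ?_⟩, ?_⟩
  · rw [← Finset.sum_coe_sort,
      e.sum_comp fun o : M.toFinset => G o * pointForm o ^ (n - M.count (o : Option ℂ) + 1)]
    exact Finset.sum_congr rfl fun o _ => (hμ o).symm
  · rw [e.sum_comp fun o : M.toFinset => M.count (o : Option ℂ), Finset.sum_coe_sort _ M.count,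
      Multiset.toFinset_sum_count_eq]

/-- The polynomial `s ↦ l ((X 1 + s * X 0) ^ n)` attached to a linear functional `l`. -/
noncomputable def dualPoly (l : MvPolynomial (Fin 2) ℂ →ₗ[ℂ] ℂ) (n : ℕ) : Polynomial ℂ :=
  ∑ k ∈ Finset.range (n + 1),
    Polynomial.monomial k (n.choose k * l (X 0 ^ k * X 1 ^ (n - k)))

section dualPoly

variable {l : MvPolynomial (Fin 2) ℂ →ₗ[ℂ] ℂ} {n : ℕ}

lemma coeff_dualPoly (k : ℕ) :
    (dualPoly l n).coeff k = n.choose k * l (X 0 ^ k * X 1 ^ (n - k)) := by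
  rw [dualPoly, Polynomial.finsetSum_coeff]
  simp only [Polynomial.coeff_monomial, Finset.sum_ite_eq', Finset.mem_range]
  split_ifs with h
  · rfl
  · simp [Nat.choose_eq_zero_of_lt (show n < k by omega)]

lemma eval_hasseDeriv_dualPoly (s : ℂ) {j : ℕ} (hj : j ≤ n) :
    (Polynomial.hasseDeriv j (dualPoly l n)).eval s =
      n.choose j * l (X 0 ^ j * (X 1 + C s * X 0) ^ (n - j)) := by
  have hexp : X 0 ^ j * (X 1 + C s * X 0 : MvPolynomial (Fin 2) ℂ) ^ (n - j) =
      ∑ i ∈ Finset.range (n - j + 1),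
        (((n - j).choose i : ℂ) * s ^ i) • (X 0 ^ (j + i) * X 1 ^ (n - (j + i))) := by
    rw [add_comm, add_pow, Finset.mul_sum]
    refine Finset.sum_congr rfl fun i _ => ?_
    rw [smul_eq_C_mul, C_mul, C_pow, Nat.sub_add_eq, map_natCast]
    ring
  rw [hexp, map_sum, Finset.mul_sum, dualPoly, map_sum, Polynomial.eval_finsetSum,
    show n + 1 = j + (n - j + 1) by omega, Finset.sum_range_add, Finset.sum_eq_zero, zero_add]
  · refine Finset.sum_congr rfl fun i _ => ?_
    have hc : ((n.choose (j + i) * (j + i).choose j : ℕ) : ℂ) =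
        (n.choose j * (n - j).choose i : ℕ) := by
      rw [Nat.choose_mul (Nat.le_add_right j i), Nat.add_sub_cancel_left]
    push_cast at hc
    rw [Polynomial.hasseDeriv_monomial, Polynomial.eval_monomial, Nat.add_sub_cancel_left,
      map_smul, smul_eq_mul]
    linear_combination (l (X 0 ^ (j + i) * X 1 ^ (n - (j + i))) * s ^ i) * hc
  · intro i hi
    rw [Polynomial.hasseDeriv_monomial, Nat.choose_eq_zero_of_lt (Finset.mem_range.1 hi)]
    simp

lemma X_sub_C_pow_dvd_dualPoly {s : ℂ} {g : ℕ} (hg : g ≤ n)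
    (h : gadSummands n (pointForm (some s)) g ≤ LinearMap.ker l) :
    (Polynomial.X - Polynomial.C s) ^ g ∣ dualPoly l n := by
  rw [Polynomial.X_sub_C_pow_dvd_iff, Polynomial.X_pow_dvd_iff]
  intro j hj
  rw [← Polynomial.taylor_apply, Polynomial.taylor_coeff, eval_hasseDeriv_dualPoly s (by omega)]
  have hG : (X 0 ^ j * (X 1 + C s * X 0) ^ (g - 1 - j) :
      MvPolynomial (Fin 2) ℂ).IsHomogeneous (g - 1) := by
    have h1 := (isHomogeneous_X_pow (R := ℂ) (0 : Fin 2) j).mul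
      ((isLinearForm_pointForm (some s)).2.pow (g - 1 - j))
    rwa [show j + 1 * (g - 1 - j) = g - 1 by omega] at h1
  have h2 := h (mul_mem_gadSummands hG)
  rw [LinearMap.mem_ker, pointForm, mul_assoc, ← pow_add,
    show g - 1 - j + (n - g + 1) = n - j by omega] at h2
  rw [h2, mul_zero]

lemma coeff_dualPoly_eq_zero {g k : ℕ} (hg : g ≤ n) (hk : n - g < k)
    (h : gadSummands n (pointForm none) g ≤ LinearMap.ker l) :
    (dualPoly l n).coeff k = 0 := by
  rw [coeff_dualPoly]
  rcases lt_or_ge n k with hnk | hkn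
  · simp [Nat.choose_eq_zero_of_lt hnk]
  have hG : (X 0 ^ (k - (n - g + 1)) * X 1 ^ (n - k) :
      MvPolynomial (Fin 2) ℂ).IsHomogeneous (g - 1) := by
    have h1 := (isHomogeneous_X_pow (R := ℂ) (0 : Fin 2) (k - (n - g + 1))).mul
      (isHomogeneous_X_pow (R := ℂ) (1 : Fin 2) (n - k))
    rwa [show k - (n - g + 1) + (n - k) = g - 1 by omega] at h1
  have h2 := h (mul_mem_gadSummands hG)
  rw [LinearMap.mem_ker, pointForm, mul_right_comm, ← pow_add,
    show k - (n - g + 1) + (n - g + 1) = k by omega] at h2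
  rw [h2, mul_zero]

end dualPoly

/-- The apolarity pairing of polynomials of degree at most `n` with the dehomogenized form `F`. -/
noncomputable def apolarPairing (F : Polynomial ℂ) (n : ℕ) : Polynomial ℂ →ₗ[ℂ] ℂ :=
  ∑ k ∈ Finset.range (n + 1), (F.coeff k / n.choose k) • Polynomial.lcoeff ℂ k

lemma apolarPairing_dualPoly (F : Polynomial ℂ) (n : ℕ) (l : MvPolynomial (Fin 2) ℂ →ₗ[ℂ] ℂ) :
    apolarPairing F n (dualPoly l n) = l (F.homogenize n) := by
  rw [Polynomial.homogenize, map_sum, Finset.Nat.sum_antidiagonal_eq_sum_range_succ_mk,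
    apolarPairing, LinearMap.sum_apply]
  refine Finset.sum_congr rfl fun k hk => ?_
  have hkn : k ≤ n := Nat.lt_succ_iff.1 (Finset.mem_range.1 hk)
  have hc : (n.choose k : ℂ) ≠ 0 := Nat.cast_ne_zero.2 (Nat.choose_pos hkn).ne'
  have hm : (monomial (fun₀ | 0 => k | 1 => n - k) (F.coeff k) : MvPolynomial (Fin 2) ℂ) =
      F.coeff k • (X 0 ^ k * X 1 ^ (n - k)) := by
    rw [← Polynomial.homogenize_X_pow hkn, Polynomial.X_pow_eq_monomial,
      Polynomial.homogenize_monomial hkn, smul_monomial, smul_eq_mul, mul_one]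
  rw [hm, map_smul, LinearMap.smul_apply, Polynomial.lcoeff_apply, coeff_dualPoly, smul_eq_mul,
    smul_eq_mul]
  field_simp

/-- A linear functional on polynomials vanishes on all multiples `Q * q`, `deg q ≤ t`, of some
nonzero `Q` of degree at most `t + 1`. -/
lemma exists_apolar (A : Polynomial ℂ →ₗ[ℂ] ℂ) (t : ℕ) :
    ∃ Q : Polynomial ℂ, Q ≠ 0 ∧ Q.natDegree ≤ t + 1 ∧
      ∀ q : Polynomial ℂ, q.natDegree ≤ t → A (Q * q) = 0 := by
  let Φ : (Fin (t + 2) → ℂ) →ₗ[ℂ] (Fin (t + 1) → ℂ) :=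
    LinearMap.pi (fun j => A ∘ₗ LinearMap.mulRight ℂ (Polynomial.X ^ (j : ℕ))) ∘ₗ
      (Polynomial.degreeLT ℂ (t + 2)).subtype ∘ₗ
      (Polynomial.degreeLTEquiv ℂ (t + 2)).symm.toLinearMap
  have hΦ : LinearMap.ker Φ ≠ ⊥ := Φ.ker_ne_bot_of_finrank_lt (by simp)
  obtain ⟨v, hv, hv0⟩ := (Submodule.ne_bot_iff _).1 hΦ
  set Q := (Polynomial.degreeLTEquiv ℂ (t + 2)).symm v
  have hQ0 : (Q : Polynomial ℂ) ≠ 0 := by simpa [Q] using hv0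
  refine ⟨Q, hQ0, ?_, fun q hq => ?_⟩
  · have := (Polynomial.natDegree_lt_iff_degree_lt hQ0).2 (Polynomial.mem_degreeLT.1 Q.2)
    omega
  · rw [q.as_sum_range' (t + 1) (by omega), Finset.mul_sum, map_sum]
    refine Finset.sum_eq_zero fun j hj => ?_
    have hA : A ((Q : Polynomial ℂ) * Polynomial.X ^ j) = 0 :=
      congrFun (LinearMap.mem_ker.1 hv) ⟨j, Finset.mem_range.1 hj⟩
    rw [← Polynomial.C_mul_X_pow_eq_monomial, mul_left_comm, ← Polynomial.smul_eq_C_mul,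
      map_smul, hA, smul_zero]

lemma hasGADLength_of_isHomogeneous {n t : ℕ} (ht : t + 1 ≤ n) (hn : n ≤ 2 * t + 1)
    {f : MvPolynomial (Fin 2) ℂ} (hf : f.IsHomogeneous n) : HasGADLength n f (t + 1) := by
  classical
  obtain ⟨F, rfl⟩ : ∃ F : Polynomial ℂ, F.homogenize n = f :=
    ⟨_, Polynomial.homogenize_eq_of_isHomogeneous hf rfl⟩
  obtain ⟨Q, hQ0, hQdeg, hQ⟩ := exists_apolar (apolarPairing F n) t
  set d := t + 1 - Q.natDegree
  let M : Multiset (Option ℂ) := Q.roots.map some + Multiset.replicate d none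
  have hMcard : M.card = t + 1 := by
    simp only [M, Multiset.card_add, Multiset.card_map, Multiset.card_replicate,
      IsAlgClosed.card_roots_eq_natDegree]
    omega
  have hMsome (s : ℂ) : M.count (some s) = Q.rootMultiplicity s := by
    simp [M, Multiset.count_map_eq_count' _ _ (Option.some_injective ℂ), Multiset.count_replicate]
  have hMnone : M.count none = d := by
    simp [M]
  have hMle (o : Option ℂ) : M.count o ≤ n := (Multiset.count_le_card o M).trans (by omega)
  rw [← hMcard]
  refine hasGADLength_card_of_mem_iSup M ?_
  by_contra hmem
  obtain ⟨l, hl, hker⟩ := Submodule.exists_le_ker_of_notMem hmem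
  refine hl ?_
  have hW (o : Option ℂ) (ho : o ∈ M) :
      gadSummands n (pointForm o) (M.count o) ≤ LinearMap.ker l :=
    (le_iSup₂_of_le o (Multiset.mem_toFinset.2 ho) le_rfl).trans hker
  rw [← apolarPairing_dualPoly]
  by_cases hp : dualPoly l n = 0
  · rw [hp, map_zero]
  have hdvd : Q ∣ dualPoly l n := by
    rw [IsAlgClosed.dvd_iff_roots_le_roots hQ0 hp, Multiset.le_iff_count]
    intro s
    rw [Polynomial.count_roots, Polynomial.count_roots]
    by_cases hs : some s ∈ M
    · rw [Polynomial.le_rootMultiplicity_iff hp, ← hMsome]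
      exact X_sub_C_pow_dvd_dualPoly (hMle _) (hW _ hs)
    · rw [← hMsome, Multiset.count_eq_zero.2 hs]
      exact Nat.zero_le _
  have hdeg : (dualPoly l n).natDegree ≤ n - d := by
    refine Polynomial.natDegree_le_iff_coeff_eq_zero.2 fun k hk => ?_
    by_cases h : none ∈ M
    · exact coeff_dualPoly_eq_zero (hMle none) (by rwa [hMnone]) (hW _ h)
    · rw [← hMnone, Multiset.count_eq_zero.2 h, Nat.sub_zero] at hk
      rw [coeff_dualPoly, Nat.choose_eq_zero_of_lt hk, Nat.cast_zero, zero_mul]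
  obtain ⟨q, hq⟩ := hdvd
  rw [hq]
  refine hQ q ?_
  rw [hq, Polynomial.natDegree_mul hQ0 (right_ne_zero_of_mul (hq ▸ hp))] at hdeg
  omega

lemma IsGAD.constantCoeff_eq_zero {n m : ℕ} {f : MvPolynomial (Fin 2) ℂ}
    {L : Fin m → MvPolynomial (Fin 2) ℂ} {g : Fin m → ℕ} {G : Fin m → MvPolynomial (Fin 2) ℂ}
    (h : IsGAD n f m L g G) : constantCoeff f = 0 := by
  rw [h.2.2.2.2, map_sum]
  refine Finset.sum_eq_zero fun i _ => ?_
  have hL : constantCoeff (L i) = 0 := (h.1 i).2.coeff_eq_zero (by simp)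
  simp [hL]

theorem length_le (n t : ℕ) (hn : n = 2 * t ∨ n = 2 * t + 1)
    (f : MvPolynomial (Fin 2) ℂ) (hf : f.IsHomogeneous n) :
    sInf {s | HasGADLength n f s} ≤ t + 1 := by
  rcases Nat.eq_zero_or_pos n with rfl | hpos
  · -- Exponents `n - g + 1` are positive here, so only the zero form has a decomposition.
    rcases Set.eq_empty_or_nonempty {s | HasGADLength 0 f s} with h | ⟨s, m, L, g, G, h, -⟩
    · simp [h]
    · have hf0 : f = 0 := by
        rw [totalDegree_eq_zero_iff_eq_C.1 ((totalDegree_zero_iff_isHomogeneous _).2 hf),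
          ← constantCoeff_eq, h.constantCoeff_eq_zero, C_0]
      refine (Nat.sInf_le ?_).trans (Nat.zero_le _)
      exact ⟨0, Fin.elim0, Fin.elim0, Fin.elim0, ⟨fun i => i.elim0, fun i => i.elim0,
        fun i => i.elim0, fun i => i.elim0, by simp [hf0]⟩, by simp⟩
  · exact Nat.sInf_le (hasGADLength_of_isHomogeneous (by omega) (by omega) hf)
end

section
/- For odd n = 2t+1, a general binary form f of degree n over ℂ has a unique decomposition (up to reordering and rescaling) as a sum of t+1 n-th powers of linear forms. -/
open MvPolynomial

/-- The `m × m` Hankel matrix `(a (r + s))`. -/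
def hankel {R : Type*} (m : ℕ) (a : ℕ → R) : Matrix (Fin m) (Fin m) R :=
  Matrix.of fun r s => a (r + s)

/-- The polynomial whose coefficients are the signed maximal minors of the `m × (m + 1)` Hankel
matrix of `a`, written through the adjugate of `hankel m a`. -/
noncomputable def apolarPoly {R : Type*} [CommRing R] (m : ℕ) (a : ℕ → R) : Polynomial R :=
  Polynomial.C (hankel m a).det * Polynomial.X ^ m -
    ∑ s : Fin m, Polynomial.C (((hankel m a).adjugate.mulVec fun r => a (m + r)) s) *
      Polynomial.X ^ (s : ℕ)

section CommRing

variable {R S : Type*} [CommRing R] [CommRing S] (m : ℕ) (a : ℕ → R)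

lemma hankel_map (φ : R →+* S) : hankel m (φ ∘ a) = φ.mapMatrix (hankel m a) := by
  ext; simp [hankel]

lemma apolarPoly_map (φ : R →+* S) :
    (apolarPoly m a).map φ = apolarPoly m (φ ∘ a) := by
  have h (s : Fin m) : ((hankel m (φ ∘ a)).adjugate.mulVec fun r => (φ ∘ a) (m + r)) s =
      φ (((hankel m a).adjugate.mulVec fun r => a (m + r)) s) := by
    rw [hankel_map, ← RingHom.map_adjugate, RingHom.map_mulVec]
    rfl
  rw [apolarPoly, apolarPoly, funext h, hankel_map, ← RingHom.map_det]
  simp only [Polynomial.map_sub, Polynomial.map_mul, Polynomial.map_sum, Polynomial.map_C,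
    Polynomial.map_pow, Polynomial.map_X]

lemma apolarPoly_coeff_top : (apolarPoly m a).coeff m = (hankel m a).det := by
  simp only [apolarPoly, Polynomial.coeff_sub, Polynomial.coeff_C_mul_X_pow,
    Polynomial.finsetSum_coeff, if_true]
  rw [Finset.sum_eq_zero, sub_zero]
  intro s _
  rw [if_neg s.isLt.ne']

lemma apolarPoly_coeff (s : Fin m) :
    (apolarPoly m a).coeff s = -((hankel m a).adjugate.mulVec fun r => a (m + r)) s := by
  simp only [apolarPoly, Polynomial.coeff_sub, Polynomial.coeff_C_mul_X_pow,
    Polynomial.finsetSum_coeff, if_neg s.isLt.ne, zero_sub, Fin.val_inj]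
  simp

lemma apolarPoly_natDegree_le : (apolarPoly m a).natDegree ≤ m := by
  refine (Polynomial.natDegree_sub_le _ _).trans (max_le ?_ ?_)
  · exact Polynomial.natDegree_C_mul_X_pow_le _ _
  · exact Polynomial.natDegree_sum_le_of_forall_le _ _ fun s _ =>
      (Polynomial.natDegree_C_mul_X_pow_le _ _).trans s.isLt.le

lemma sum_apolarPoly_coeff_mul (r : Fin m) :
    ∑ s ∈ Finset.range (m + 1), (apolarPoly m a).coeff s * a (r + s) = 0 := by
  rw [Finset.sum_range_succ, Finset.sum_range, apolarPoly_coeff_top]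
  simp only [apolarPoly_coeff]
  have h : (hankel m a).mulVec ((hankel m a).adjugate.mulVec fun r => a (m + r)) =
      (hankel m a).det • fun r : Fin m => a (m + r) := by
    rw [Matrix.mulVec_mulVec, Matrix.mul_adjugate, Matrix.smul_mulVec, Matrix.one_mulVec]
  have h := congrFun h r
  simp only [Matrix.mulVec, dotProduct, hankel, Matrix.of_apply, Pi.smul_apply, smul_eq_mul] at h ⊢
  rw [add_comm m] at h
  rw [← h, ← Finset.sum_add_distrib]
  exact Finset.sum_eq_zero fun s _ => by ring

variable {m a}

lemma det_hankel_of_eq_sum {d u v : Fin m → R}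
    (h : ∀ i < 2 * m, a i = ∑ j, d j * u j ^ (2 * m - 1 - i) * v j ^ i) :
    (hankel m a).det = (∏ j, d j * u j) * (Matrix.projVandermonde v u).det ^ 2 := by
  have key : hankel m a = (Matrix.projVandermonde v u).transpose *
      Matrix.diagonal (fun j => d j * u j) * Matrix.projVandermonde v u := by
    ext r s
    rw [Matrix.mul_apply]
    simp only [Matrix.mul_diagonal, Matrix.transpose_apply, Matrix.projVandermonde_apply,
      hankel, Matrix.of_apply, Fin.val_rev]
    rw [h _ (by omega)]
    refine Finset.sum_congr rfl fun j _ => ?_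
    rw [show 2 * m - 1 - ((r : ℕ) + s) = (m - (r + 1)) + (m - (s + 1)) + 1 by omega]
    ring
  rw [key, Matrix.det_mul, Matrix.det_mul, Matrix.det_transpose, Matrix.det_diagonal]
  ring

lemma sum_coeff_mul_sum_pow {p : Polynomial R} (hp : p.natDegree ≤ m) {D z : Fin m → R}
    (h : ∀ i < 2 * m, a i = ∑ j, D j * z j ^ i) (r : Fin m) :
    ∑ s ∈ Finset.range (m + 1), p.coeff s * a (r + s) =
      ∑ j, D j * z j ^ (r : ℕ) * p.eval (z j) := by
  simp only [Polynomial.eval_eq_sum_range' (Nat.lt_succ_of_le hp), Finset.mul_sum]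
  rw [Finset.sum_comm]
  refine Finset.sum_congr rfl fun s hs => ?_
  rw [h _ (by have := Finset.mem_range.1 hs; omega), Finset.mul_sum]
  exact Finset.sum_congr rfl fun j _ => by ring

lemma apolarPoly_eq_prod [Nontrivial R] {D z : Fin m → R}
    (h : ∀ i < 2 * m, a i = ∑ j, D j * z j ^ i) :
    apolarPoly m a = Polynomial.C (hankel m a).det * ∏ j, (Polynomial.X - Polynomial.C (z j)) := by
  set W : Polynomial R := ∏ j, (Polynomial.X - Polynomial.C (z j)) with hW
  have hmon : W.Monic := Polynomial.monic_prod_X_sub_C _ _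
  have hdeg : W.natDegree = m := by
    rw [hW, Polynomial.natDegree_finsetProd_X_sub_C_eq_card]; simp
  have htop : W.coeff m = 1 := by rw [← hdeg]; exact hmon.coeff_natDegree
  have hker : (hankel m a).mulVec (fun s => W.coeff s) = -fun r : Fin m => a (m + r) := by
    ext r
    have h0 := sum_coeff_mul_sum_pow hdeg.le h r
    rw [Finset.sum_eq_zero (s := Finset.univ), Finset.sum_range_succ, Finset.sum_range, htop,
      one_mul, add_comm (r : ℕ) m] at h0
    · rw [Pi.neg_apply, ← eq_neg_of_add_eq_zero_left h0]
      simp only [Matrix.mulVec, dotProduct, hankel, Matrix.of_apply]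
      exact Finset.sum_congr rfl fun s _ => mul_comm _ _
    · intro j _
      rw [hW, Polynomial.eval_prod, Finset.prod_eq_zero (Finset.mem_univ j) (by simp), mul_zero]
  have hadj := congrArg (hankel m a).adjugate.mulVec hker
  rw [Matrix.mulVec_mulVec, Matrix.adjugate_mul, Matrix.smul_mulVec, Matrix.one_mulVec,
    Matrix.mulVec_neg] at hadj
  ext i
  rw [Polynomial.coeff_C_mul]
  rcases lt_trichotomy i m with hi | rfl | hi
  · have := congrFun hadj ⟨i, hi⟩
    have h2 := apolarPoly_coeff m a ⟨i, hi⟩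
    simp only [Pi.smul_apply, Pi.neg_apply, smul_eq_mul] at this h2
    rw [h2, this]
  · rw [apolarPoly_coeff_top, htop, mul_one]
  · rw [Polynomial.coeff_eq_zero_of_natDegree_lt ((apolarPoly_natDegree_le m a).trans_lt hi),
      Polynomial.coeff_eq_zero_of_natDegree_lt (hdeg.trans_lt hi), mul_zero]

end CommRing

section Field

variable {K : Type*} [Field K] {m : ℕ} {a : ℕ → K}

lemma apolarPoly_natDegree (h : (hankel m a).det ≠ 0) : (apolarPoly m a).natDegree = m :=
  Polynomial.natDegree_eq_of_le_of_coeff_ne_zero (apolarPoly_natDegree_le m a)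
    (by rwa [apolarPoly_coeff_top])

lemma exists_sum_pow_of_separable [IsAlgClosed K] (h : (hankel m a).det ≠ 0)
    (hs : (apolarPoly m a).Separable) :
    ∃ z D : Fin m → K, Function.Injective z ∧ ∀ i < 2 * m, a i = ∑ j, D j * z j ^ i := by
  classical
  set q := apolarPoly m a with hq
  have hcard : Fintype.card (Fin m) = Fintype.card q.roots.toFinset := by
    rw [Fintype.card_coe, Multiset.toFinset_card_of_nodup (Polynomial.nodup_roots hs),
      ← (IsAlgClosed.splits q).natDegree_eq_card_roots, apolarPoly_natDegree h, Fintype.card_fin]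
  let e : Fin m ≃ q.roots.toFinset := Fintype.equivOfCardEq hcard
  let z : Fin m → K := fun j => e j
  have hz : Function.Injective z := Subtype.val_injective.comp e.injective
  have hroot (j) : q.eval (z j) = 0 :=
    (Polynomial.mem_roots'.1 (Multiset.mem_toFinset.1 (e j).2)).2
  have hV : IsUnit (Matrix.vandermonde z) := by
    rw [Matrix.isUnit_iff_isUnit_det]
    exact (Matrix.det_vandermonde_ne_zero_iff.2 hz).isUnit
  obtain ⟨D, hD⟩ := Matrix.vecMul_surjective_iff_isUnit.2 hV fun i : Fin m => a i
  refine ⟨z, D, hz, fun i => ?_⟩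
  induction i using Nat.strong_induction_on with
  | _ i ih =>
    intro hi
    rcases lt_or_ge i m with him | him
    · have := congrFun hD ⟨i, him⟩
      simpa [Matrix.vecMul, dotProduct] using this.symm
    · have h1 := sum_apolarPoly_coeff_mul m a ⟨i - m, by omega⟩
      let b : ℕ → K := fun i => ∑ j, D j * z j ^ i
      have h2 := sum_coeff_mul_sum_pow (a := b) (D := D) (z := z)
        (apolarPoly_natDegree_le m a) (fun _ _ => rfl) ⟨i - m, by omega⟩
      rw [Finset.sum_eq_zero (s := Finset.univ) fun j _ => by
        rw [← hq, hroot, mul_zero]] at h2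
      rw [← h2, Finset.sum_range_succ, Finset.sum_range_succ, apolarPoly_coeff_top,
        Nat.sub_add_cancel him] at h1
      rw [Finset.sum_congr rfl fun s hs => by
        rw [ih (i - m + s) (by have := Finset.mem_range.1 hs; omega)
          (by have := Finset.mem_range.1 hs; omega)]] at h1
      exact mul_left_cancel₀ h (add_left_cancel h1)

/-- Two expressions of the same nondegenerate sequence as power sums agree up to order. -/
lemma exists_equiv_of_sum_pow (h : (hankel m a).det ≠ 0) {z D z' D' : Fin m → K}
    (hz' : Function.Injective z')
    (ha : ∀ i < 2 * m, a i = ∑ j, D j * z j ^ i)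
    (ha' : ∀ i < 2 * m, a i = ∑ j, D' j * z' j ^ i) :
    ∃ σ : Fin m ≃ Fin m, ∀ j, z' j = z (σ j) ∧ D' j = D (σ j) := by
  have hprod := (apolarPoly_eq_prod ha').symm.trans (apolarPoly_eq_prod ha)
  have hmem (j) : ∃ k, z' j = z k := by
    have := congrArg (Polynomial.eval (z' j)) hprod
    simp only [Polynomial.eval_mul, Polynomial.eval_C, Polynomial.eval_prod, Polynomial.eval_sub,
      Polynomial.eval_X] at this
    rw [Finset.prod_eq_zero (Finset.mem_univ j) (sub_self (z' j)), mul_zero, eq_comm, mul_eq_zero,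
      or_iff_right h, Finset.prod_eq_zero_iff] at this
    obtain ⟨k, -, hk⟩ := this
    exact ⟨k, sub_eq_zero.1 hk⟩
  choose f hf using hmem
  have hinj : Function.Injective f := fun i j hij => hz' (by rw [hf, hf, hij])
  let σ : Fin m ≃ Fin m := Equiv.ofBijective f (Finite.injective_iff_bijective.1 hinj)
  have hD : (fun j => D' j - D (σ j)) = 0 := by
    refine Matrix.eq_zero_of_forall_pow_sum_mul_pow_eq_zero hz' fun i => ?_
    have h1 : ∑ j, D (σ j) * z (σ j) ^ (i : ℕ) = ∑ j, D j * z j ^ (i : ℕ) :=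
      Equiv.sum_comp σ fun j => D j * z j ^ (i : ℕ)
    simp only [sub_mul, Finset.sum_sub_distrib]
    rw [← ha' i (by omega), sub_eq_zero, ha i (by omega), ← h1]
    exact Finset.sum_congr rfl fun j _ => by rw [hf j]; rfl
  exact ⟨σ, fun j => ⟨hf j, sub_eq_zero.1 (congrFun hD j)⟩⟩

end Field

section BinaryForm

variable {n : ℕ}

lemma coeff_binaryForm (c : Fin (n + 1) → ℂ) (k : Fin (n + 1)) :
    coeff (Finsupp.single 0 (n - (k : ℕ)) + Finsupp.single 1 (k : ℕ))
      (∑ i : Fin (n + 1), C (c i) * X (0 : Fin 2) ^ (n - (i : ℕ)) * X 1 ^ (i : ℕ)) = c k := by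
  have hmono (i : Fin (n + 1)) : C (c i) * X (0 : Fin 2) ^ (n - (i : ℕ)) * X 1 ^ (i : ℕ) =
      monomial (Finsupp.single 0 (n - (i : ℕ)) + Finsupp.single 1 (i : ℕ)) (c i) := by
    rw [X_pow_eq_monomial, X_pow_eq_monomial, mul_assoc, monomial_mul, C_mul_monomial]
    simp
  simp only [hmono, coeff_sum, coeff_monomial]
  rw [Finset.sum_eq_single k _ (by simp), if_pos rfl]
  intro i _ hik
  rw [if_neg]
  intro h
  have := DFunLike.congr_fun h 1
  simp at this
  exact hik (Fin.ext this)

lemma binaryForm_injective : Function.Injective fun c : Fin (n + 1) → ℂ =>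
    ∑ i : Fin (n + 1), C (c i) * X (0 : Fin 2) ^ (n - (i : ℕ)) * X 1 ^ (i : ℕ) := by
  intro c c' h
  ext k
  rw [← coeff_binaryForm c k, ← coeff_binaryForm c' k]
  exact congrArg _ h

lemma sum_smul_linear_pow {ι : Type*} [Fintype ι] (d u v : ι → ℂ) :
    ∑ j, d j • (C (u j) * X (0 : Fin 2) + C (v j) * X 1) ^ n =
      ∑ i : Fin (n + 1), C ((n.choose i : ℂ) * ∑ j, d j * u j ^ (n - (i : ℕ)) * v j ^ (i : ℕ)) *
        X (0 : Fin 2) ^ (n - (i : ℕ)) * X 1 ^ (i : ℕ) := by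
  simp only [Finset.mul_sum, map_sum, Finset.sum_mul]
  rw [Finset.sum_comm]
  refine Finset.sum_congr rfl fun j _ => ?_
  rw [add_comm, add_pow, Finset.sum_range, Finset.smul_sum]
  refine Finset.sum_congr rfl fun i _ => ?_
  simp only [smul_eq_C_mul, mul_pow, map_mul, map_pow, map_natCast]
  ring

lemma exists_eq_of_isHomogeneous_one {L : MvPolynomial (Fin 2) ℂ} (h : L.IsHomogeneous 1) :
    ∃ u v : ℂ, L = C u * X 0 + C v * X 1 := by
  rw [← mem_homogeneousSubmodule, homogeneousSubmodule_one_eq_span_X,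
    Submodule.mem_span_range_iff_exists_fun] at h
  obtain ⟨w, rfl⟩ := h
  exact ⟨w 0, w 1, by simp [smul_eq_C_mul]⟩

lemma isLinearForm_X_add (z : ℂ) : IsLinearForm (C 1 * X 0 + C z * X 1) := by
  constructor
  · intro h
    have := congrArg (eval ![1, 0]) h
    simp at this
  · exact ((isHomogeneous_X _ _).C_mul _).add ((isHomogeneous_X _ _).C_mul _)

lemma proportional_X_add_iff {z w : ℂ} :
    Proportional (C 1 * X 0 + C z * X 1) (C 1 * X 0 + C w * X 1) ↔ z = w := by
  constructor
  · rintro ⟨c, h⟩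
    have h0 := congrArg (eval ![1, 0]) h
    have h1 := congrArg (eval ![0, 1]) h
    simp [smul_eval] at h0 h1
    simp [h1, ← h0]
  · rintro rfl
    exact ⟨1, (one_smul _ _).symm⟩

lemma proportional_of_div_eq {u v u' v' : ℂ} (hu : u ≠ 0) (hu' : u' ≠ 0) (h : v / u = v' / u') :
    Proportional (C u * X 0 + C v * X 1) (C u' * X 0 + C v' * X 1) := by
  refine ⟨u' / u, ?_⟩
  have hv : v' = u' / u * v := by field_simp at h ⊢; exact h.symm
  rw [hv, smul_eq_C_mul, mul_add, ← mul_assoc, ← mul_assoc, ← C_mul, ← C_mul, div_mul_cancel₀ _ hu]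

end BinaryForm

section Generic

variable (t : ℕ)

/-- The coefficients of a binary form of degree `2 * t + 1` divided by the binomial coefficients,
extended by zero. -/
noncomputable def momentSeq {R : Type*} [CommRing R] [Algebra ℂ R] (c : Fin (2 * t + 2) → R)
    (i : ℕ) : R :=
  if h : i < 2 * t + 2 then algebraMap ℂ R ((2 * t + 1).choose i : ℂ)⁻¹ * c ⟨i, h⟩ else 0

lemma momentSeq_eq_iff {c : Fin (2 * t + 2) → ℂ} {i : Fin (2 * t + 2)} {s : ℂ} :
    momentSeq t c i = s ↔ c i = ((2 * t + 1).choose i : ℂ) * s := by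
  have : ((2 * t + 1).choose i : ℂ) ≠ 0 := by
    exact_mod_cast (Nat.choose_pos (by omega)).ne'
  simp only [momentSeq, i.isLt, dif_pos, Algebra.algebraMap_self, RingHom.id_apply]
  exact inv_mul_eq_iff_eq_mul₀ this

lemma eval_comp_momentSeq (c : Fin (2 * t + 2) → ℂ) :
    eval c ∘ momentSeq t (X : _ → MvPolynomial (Fin (2 * t + 2)) ℂ) = momentSeq t c := by
  ext i
  simp only [momentSeq, Function.comp_apply]
  split_ifs <;> simp [algebraMap_eq]

/-- The product of the middle catalecticant determinant and the resultant
of the apolar polynomial with its derivative. -/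
noncomputable def genericityPoly : MvPolynomial (Fin (2 * t + 2)) ℂ :=
  (hankel (t + 1) (momentSeq t X)).det *
    (apolarPoly (t + 1) (momentSeq t X)).resultant
      (apolarPoly (t + 1) (momentSeq t X)).derivative (t + 1) t

lemma eval_genericityPoly_ne_zero_iff {c : Fin (2 * t + 2) → ℂ} :
    eval c (genericityPoly t) ≠ 0 ↔ (hankel (t + 1) (momentSeq t c)).det ≠ 0 ∧
      (apolarPoly (t + 1) (momentSeq t c)).Separable := by
  rw [genericityPoly, map_mul, ← Polynomial.resultant_map_map, ← Polynomial.derivative_map,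
    apolarPoly_map, eval_comp_momentSeq, RingHom.map_det, ← hankel_map, eval_comp_momentSeq,
    mul_ne_zero_iff]
  refine and_congr_right fun h => ?_
  have hdeg := apolarPoly_natDegree h
  have hdeg' : (apolarPoly (t + 1) (momentSeq t c)).derivative.natDegree = t := by
    rw [Polynomial.natDegree_derivative, hdeg, Nat.add_sub_cancel]
  have hne : apolarPoly (t + 1) (momentSeq t c) ≠ 0 := by
    intro h0
    rw [h0, Polynomial.natDegree_zero] at hdeg
    omega
  have := Polynomial.resultant_eq_zero_iff (f := apolarPoly (t + 1) (momentSeq t c))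
    (g := (apolarPoly (t + 1) (momentSeq t c)).derivative)
  rw [hdeg, hdeg'] at this
  rw [Ne, this, Polynomial.Separable]
  simp [hne]

lemma genericityPoly_ne_zero : genericityPoly t ≠ 0 := by
  let z : Fin (t + 1) → ℂ := fun j => (j : ℕ)
  have hz : Function.Injective z := fun i j h => Fin.ext (Nat.cast_injective h)
  let c : Fin (2 * t + 2) → ℂ := fun i => ((2 * t + 1).choose i : ℂ) * ∑ j, z j ^ (i : ℕ)
  have ha : ∀ i < 2 * (t + 1), momentSeq t c i = ∑ j, 1 * z j ^ i := fun i hi => by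
    simpa using (momentSeq_eq_iff t (i := ⟨i, hi⟩)).2 rfl
  have hdet : (hankel (t + 1) (momentSeq t c)).det ≠ 0 := by
    rw [det_hankel_of_eq_sum (d := 1) (u := 1) (v := z) (by simpa using ha),
      ← Matrix.vandermonde_eq_projVandermonde]
    simpa using Matrix.det_vandermonde_ne_zero_iff.2 hz
  have : eval c (genericityPoly t) ≠ 0 := by
    refine (eval_genericityPoly_ne_zero_iff t).2 ⟨hdet, ?_⟩
    rw [apolarPoly_eq_prod ha]
    exact (Polynomial.separable_prod_X_sub_C_iff.2 hz).unit_mul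
      (Polynomial.isUnit_C.2 hdet.isUnit)
  rintro h
  simp [h] at this

lemma binaryForm_eq_iff {c : Fin (2 * t + 2) → ℂ} {d u v : Fin (t + 1) → ℂ} :
    (∑ i : Fin (2 * t + 2), C (c i) * X (0 : Fin 2) ^ (2 * t + 1 - (i : ℕ)) * X 1 ^ (i : ℕ)) =
        ∑ j, d j • (C (u j) * X 0 + C (v j) * X 1) ^ (2 * t + 1) ↔
      ∀ i < 2 * (t + 1), momentSeq t c i = ∑ j, d j * u j ^ (2 * (t + 1) - 1 - i) * v j ^ i := by
  rw [sum_smul_linear_pow]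
  constructor
  · intro h i hi
    exact (momentSeq_eq_iff t (i := ⟨i, hi⟩)).2 (congrFun (binaryForm_injective h) ⟨i, hi⟩)
  · intro h
    refine Finset.sum_congr rfl fun i _ => ?_
    rw [(momentSeq_eq_iff t).1 (h i i.isLt)]
    rfl

end Generic

theorem sylvester_odd (t : ℕ) :
    ∃ P : MvPolynomial (Fin (2 * t + 2)) ℂ, P ≠ 0 ∧
      ∀ c : Fin (2 * t + 2) → ℂ, MvPolynomial.eval c P ≠ 0 →
        ∃ L : Fin (t + 1) → MvPolynomial (Fin 2) ℂ, ∃ d : Fin (t + 1) → ℂ,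
          (∀ i, IsLinearForm (L i)) ∧
          (∀ i j, i ≠ j → ¬ Proportional (L i) (L j)) ∧
          (∀ i, d i ≠ 0) ∧
          (∑ i : Fin (2 * t + 2), C (c i) * X (0 : Fin 2) ^ (2 * t + 1 - (i : ℕ)) * X 1 ^ (i : ℕ))
            = ∑ i, d i • (L i) ^ (2 * t + 1) ∧
          ∀ (L' : Fin (t + 1) → MvPolynomial (Fin 2) ℂ) (d' : Fin (t + 1) → ℂ),
            (∀ i, IsLinearForm (L' i)) →
            (∀ i j, i ≠ j → ¬ Proportional (L' i) (L' j)) →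
            (∀ i, d' i ≠ 0) →
            (∑ i : Fin (2 * t + 2), C (c i) * X (0 : Fin 2) ^ (2 * t + 1 - (i : ℕ)) * X 1 ^ (i : ℕ))
              = ∑ i, d' i • (L' i) ^ (2 * t + 1) →
            ∃ σ : Fin (t + 1) ≃ Fin (t + 1), ∀ i,
              d' i • (L' i) ^ (2 * t + 1) = d (σ i) • (L (σ i)) ^ (2 * t + 1) := by
  refine ⟨genericityPoly t, genericityPoly_ne_zero t, fun c hc => ?_⟩
  obtain ⟨hdet, hsep⟩ := (eval_genericityPoly_ne_zero_iff t).1 hc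
  obtain ⟨z, D, hz, ha⟩ := exists_sum_pow_of_separable hdet hsep
  have ha1 : ∀ i < 2 * (t + 1), momentSeq t c i =
      ∑ j, D j * (1 : Fin (t + 1) → ℂ) j ^ (2 * (t + 1) - 1 - i) * z j ^ i := by
    simpa using ha
  refine ⟨fun j => C 1 * X 0 + C (z j) * X 1, D, fun j => isLinearForm_X_add _,
    fun i j hij h => hij (hz (proportional_X_add_iff.1 h)), fun j => ?_,
    (binaryForm_eq_iff t).2 ha1, fun L' d' hL' hprop _ hsum => ?_⟩
  · rw [det_hankel_of_eq_sum ha1] at hdet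
    have := Finset.prod_ne_zero_iff.1 (left_ne_zero_of_mul hdet) j (Finset.mem_univ j)
    exact left_ne_zero_of_mul this
  · choose u v huv using fun j => exists_eq_of_isHomogeneous_one (hL' j).2
    obtain rfl : L' = fun j => C (u j) * X 0 + C (v j) * X 1 := funext huv
    have ha' := (binaryForm_eq_iff t).1 hsum
    have hu (j) : u j ≠ 0 := by
      have hdet' := hdet
      rw [det_hankel_of_eq_sum ha'] at hdet'
      have := Finset.prod_ne_zero_iff.1 (left_ne_zero_of_mul hdet') j (Finset.mem_univ j)
      exact right_ne_zero_of_mul this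
    have hz' : Function.Injective fun j => v j / u j := fun i j h => by
      by_contra hij
      exact hprop i j hij (proportional_of_div_eq (hu i) (hu j) h)
    obtain ⟨σ, hσ⟩ := exists_equiv_of_sum_pow hdet hz' ha
      (D' := fun j => d' j * u j ^ (2 * t + 1)) fun i hi => by
        rw [ha' i hi]
        refine Finset.sum_congr rfl fun j _ => ?_
        have : u j ^ (2 * t + 1) = u j ^ (2 * (t + 1) - 1 - i) * u j ^ i := by
          rw [← pow_add]
          congr 1
          omega
        rw [this, div_pow]
        field_simp [hu j]
    refine ⟨σ, fun j => ?_⟩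
    obtain ⟨h1, h2⟩ := hσ j
    have hL : C (u j) * X 0 + C (v j) * X 1 =
        C (u j) * (C 1 * X (0 : Fin 2) + C (z (σ j)) * X 1) := by
      rw [mul_add, ← mul_assoc, ← mul_assoc, ← C_mul, ← C_mul, mul_one, ← h1,
        mul_div_cancel₀ _ (hu j)]
    simp only [hL, ← h2, mul_pow, smul_eq_C_mul, map_mul, map_pow]
    ring
end

section
/- Let f be a binary form of degree n, let s = l(f) be its length, and suppose 1 ≤ s ≤ e ≤ n - e + 1. Then rank Cat_f(n-e, e) = s. -/
open MvPolynomial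

theorem pderiv_comm (i j : Fin 2) (h : MvPolynomial (Fin 2) ℂ) :
    pderiv i (pderiv j h) = pderiv j (pderiv i h) := by
  have key : ⁅(pderiv i : Derivation ℂ (MvPolynomial (Fin 2) ℂ) _), pderiv j⁆ = 0 :=
    derivation_ext fun k => by
      rw [Derivation.commutator_apply, pderiv_X, pderiv_X, Pi.single_apply, Pi.single_apply]
      split_ifs <;> simp
  simpa [Derivation.commutator_apply, sub_eq_zero] using DFunLike.congr_fun key h

open scoped IsMulCommutative in
/-- The action of dual forms by constant-coefficient differential operators. -/
noncomputable def diffOp :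
    MvPolynomial (Fin 2) ℂ →ₐ[ℂ] Module.End ℂ (MvPolynomial (Fin 2) ℂ) :=
  let S : Set (Module.End ℂ (MvPolynomial (Fin 2) ℂ)) :=
    Set.range fun i : Fin 2 => (pderiv i).toLinearMap
  haveI : IsMulCommutative (Algebra.adjoin ℂ S) := Algebra.isMulCommutative_adjoin ℂ (by
    rintro _ ⟨i, rfl⟩ _ ⟨j, rfl⟩
    exact LinearMap.ext fun h => pderiv_comm i j h)
  (Algebra.adjoin ℂ S).val.comp
    (aeval fun i => (⟨_, Algebra.subset_adjoin ⟨i, rfl⟩⟩ : Algebra.adjoin ℂ S))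

theorem diffOp_mul (φ ψ h : MvPolynomial (Fin 2) ℂ) :
    diffOp (φ * ψ) h = diffOp φ (diffOp ψ h) := by
  rw [map_mul, Module.End.mul_apply]

theorem diffOp_X (i : Fin 2) (h : MvPolynomial (Fin 2) ℂ) : diffOp (X i) h = pderiv i h := by
  simp [diffOp]

theorem diffOp_monomial (m : Fin 2 →₀ ℕ) (c : ℂ) (h : MvPolynomial (Fin 2) ℂ) :
    diffOp (monomial m c) h =
      c • ((fun p => pderiv (0 : Fin 2) p)^[m 0] ((fun p => pderiv (1 : Fin 2) p)^[m 1] h)) := by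
  have hX (i : Fin 2) : ⇑(diffOp (X i)) = fun p => pderiv i p := funext (diffOp_X i)
  rw [monomial_eq, Finsupp.prod_fintype _ _ (by simp), Fin.prod_univ_two, ← algebraMap_eq,
    ← Algebra.smul_def, map_smul, map_mul, map_pow, map_pow, LinearMap.smul_apply,
    Module.End.mul_apply, Module.End.pow_apply, Module.End.pow_apply, hX, hX]

theorem diffOp_apply (φ h : MvPolynomial (Fin 2) ℂ) : diffOp φ h = contractOp φ h := by
  conv_lhs => rw [φ.as_sum, map_sum, LinearMap.sum_apply]
  exact Finset.sum_congr rfl fun m _ => diffOp_monomial m _ h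

/-- The binary linear form with coefficients `a` and `b`. -/
noncomputable def linForm (a b : ℂ) : MvPolynomial (Fin 2) ℂ := C a * X 0 + C b * X 1

theorem isHomogeneous_linForm (a b : ℂ) : (linForm a b).IsHomogeneous 1 :=
  (isHomogeneous_C_mul_X a 0).add (isHomogeneous_C_mul_X b 1)

theorem exists_eq_linForm {L : MvPolynomial (Fin 2) ℂ} (hL : L.IsHomogeneous 1) :
    ∃ a b, L = linForm a b := by
  rw [← mem_homogeneousSubmodule, homogeneousSubmodule_one_eq_span_X,
    Submodule.mem_span_range_iff_exists_fun] at hL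
  obtain ⟨c, rfl⟩ := hL
  exact ⟨c 0, c 1, by simp [linForm, Fin.sum_univ_two, smul_eq_C_mul]⟩

theorem diffOp_linForm (a b : ℂ) (h : MvPolynomial (Fin 2) ℂ) :
    diffOp (linForm a b) h = C a * pderiv 0 h + C b * pderiv 1 h := by
  simp only [linForm, ← smul_eq_C_mul, map_add, map_smul, LinearMap.add_apply,
    LinearMap.smul_apply, diffOp_X]

theorem diffOp_linForm_linForm (a b p q : ℂ) :
    diffOp (linForm a b) (linForm p q) = C (a * p + b * q) := by
  simp [diffOp_linForm]
  simp [linForm]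

theorem diffOp_linForm_mul (a b : ℂ) (g h : MvPolynomial (Fin 2) ℂ) :
    diffOp (linForm a b) (g * h) =
      diffOp (linForm a b) g * h + g * diffOp (linForm a b) h := by
  simp only [diffOp_linForm, pderiv_mul]
  ring

theorem isHomogeneous_diffOp_linForm (a b : ℂ) {h : MvPolynomial (Fin 2) ℂ} {d : ℕ}
    (hh : h.IsHomogeneous d) : (diffOp (linForm a b) h).IsHomogeneous (d - 1) := by
  rw [diffOp_linForm]
  exact (hh.pderiv.C_mul a).add (hh.pderiv.C_mul b)

/-- An operator annihilating the linear form `L` passes through powers of `L`. -/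
theorem diffOp_linForm_pow_mul_pow (p q : ℂ) (k r : ℕ) (g : MvPolynomial (Fin 2) ℂ) :
    diffOp (linForm q (-p) ^ k) (g * linForm p q ^ r) =
      diffOp (linForm q (-p) ^ k) g * linForm p q ^ r := by
  have h0 : diffOp (linForm q (-p)) (linForm p q ^ r) = 0 := by
    induction r with
    | zero => simp [diffOp_linForm]
    | succ r ih =>
      rw [pow_succ, diffOp_linForm_mul, ih, diffOp_linForm_linForm]
      simp [mul_comm]
  induction k with
  | zero => simp
  | succ k ih =>
    rw [pow_succ', diffOp_mul, ih, diffOp_linForm_mul, h0, mul_zero, add_zero, diffOp_mul]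

theorem isHomogeneous_diffOp_linForm_pow (a b : ℂ) (k : ℕ) {h : MvPolynomial (Fin 2) ℂ} {d : ℕ}
    (hh : h.IsHomogeneous d) : (diffOp (linForm a b ^ k) h).IsHomogeneous (d - k) := by
  induction k with
  | zero => simpa
  | succ k ih =>
    rw [pow_succ', diffOp_mul, ← Nat.sub_sub]
    exact isHomogeneous_diffOp_linForm a b ih

theorem exists_diffOp_linForm_pow_eq_C (a b : ℂ) {h : MvPolynomial (Fin 2) ℂ} {d : ℕ}
    (hh : h.IsHomogeneous d) : ∃ c, diffOp (linForm a b ^ d) h = C c := by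
  have := isHomogeneous_diffOp_linForm_pow a b d hh
  rw [Nat.sub_self] at this
  exact ⟨_, totalDegree_eq_zero_iff_eq_C.1 ((totalDegree_zero_iff_isHomogeneous _).2 this)⟩

theorem diffOp_linForm_pow_eq_zero (a b : ℂ) {h : MvPolynomial (Fin 2) ℂ} {d k : ℕ}
    (hh : h.IsHomogeneous d) (hk : d < k) : diffOp (linForm a b ^ k) h = 0 := by
  obtain ⟨c, hc⟩ := exists_diffOp_linForm_pow_eq_C a b hh
  obtain ⟨l, rfl⟩ := Nat.exists_eq_add_of_lt hk
  rw [show d + l + 1 = l + (1 + d) by ring, pow_add, pow_add, diffOp_mul, diffOp_mul, hc]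
  simp [diffOp_linForm]

theorem exists_eq_mul_linForm {p q : ℂ} (hpq : p ≠ 0 ∨ q ≠ 0) (d : ℕ)
    {g : MvPolynomial (Fin 2) ℂ} (hg : g.IsHomogeneous d)
    (h0 : diffOp (linForm q (-p) ^ d) g = 0) :
    ∃ h, h.IsHomogeneous (d - 1) ∧ (d = 0 → h = 0) ∧ g = h * linForm p q := by
  obtain ⟨u, w, huw⟩ : ∃ u w : ℂ, u * p + w * q = 1 := by
    rcases hpq with h | h
    · exact ⟨p⁻¹, 0, by simp [h]⟩
    · exact ⟨0, q⁻¹, by simp [h]⟩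
  induction d generalizing g with
  | zero => exact ⟨0, isHomogeneous_zero .., fun _ => rfl, by simpa using h0⟩
  | succ d ih =>
    obtain ⟨h, hh, hd, hgh⟩ := ih (isHomogeneous_diffOp_linForm q (-p) hg)
      (by rwa [pow_succ, diffOp_mul] at h0)
    have hY : (linForm w (-u) * h).IsHomogeneous d := by
      rcases Nat.eq_zero_or_pos d with rfl | hd'
      · rw [hd rfl, mul_zero]
        exact isHomogeneous_zero ..
      · convert (isHomogeneous_linForm w (-u)).mul hh using 1
        omega
    have huw' : (C u * C p + C w * C q : MvPolynomial (Fin 2) ℂ) = 1 := by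
      rw [← C_mul, ← C_mul, ← C_add, huw, C_1]
    have euler := hg.sum_X_mul_pderiv
    rw [Fin.sum_univ_two] at euler
    have key : ((d + 1 : ℕ) : ℂ) • g =
        (diffOp (linForm u w) g + linForm w (-u) * h) * linForm p q := by
      rw [add_mul, mul_assoc, ← hgh, Nat.cast_smul_eq_nsmul, ← euler, diffOp_linForm,
        diffOp_linForm]
      simp only [linForm, C_neg]
      linear_combination (-(X 0 * pderiv 0 g + X 1 * pderiv 1 g)) * huw'
    refine ⟨C ((d + 1 : ℕ) : ℂ)⁻¹ * (diffOp (linForm u w) g + linForm w (-u) * h),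
      ((isHomogeneous_diffOp_linForm u w hg).add hY).C_mul _, by simp, ?_⟩
    rw [mul_assoc, ← key, ← smul_eq_C_mul, inv_smul_smul₀ (Nat.cast_ne_zero.2 d.succ_ne_zero)]

theorem iterate_pderiv_linForm_pow (i : Fin 2) (v : Fin 2 → ℂ) (k r : ℕ) :
    (fun h => pderiv i h)^[k] (linForm (v 0) (v 1) ^ r) =
      C (r.descFactorial k * v i ^ k : ℂ) * linForm (v 0) (v 1) ^ (r - k) := by
  have h1 : pderiv i (linForm (v 0) (v 1)) = C (v i) := by
    fin_cases i <;> simp [linForm]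
  induction k with
  | zero => simp
  | succ k ih =>
    rw [Function.iterate_succ_apply', ih]
    simp only [pderiv_C_mul, pderiv_pow, h1, Nat.descFactorial_succ, Nat.sub_sub]
    simp only [Nat.cast_mul, C_mul, C_pow, pow_succ, map_natCast]
    ring

theorem diffOp_linForm_pow_right (v : Fin 2 → ℂ) {φ : MvPolynomial (Fin 2) ℂ} {t : ℕ}
    (hφ : φ.IsHomogeneous t) (r : ℕ) :
    diffOp φ (linForm (v 0) (v 1) ^ r) =
      C (r.descFactorial t * eval v φ) * linForm (v 0) (v 1) ^ (r - t) := by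
  have hmon (m : Fin 2 →₀ ℕ) (c : ℂ) (hm : m.degree = t) :
      diffOp (monomial m c) (linForm (v 0) (v 1) ^ r) =
        C (r.descFactorial t * eval v (monomial m c)) * linForm (v 0) (v 1) ^ (r - t) := by
    have ht : m 1 + m 0 = t := by
      rw [← hm, Finsupp.degree_eq_sum, Fin.sum_univ_two, add_comm]
    have hfac := Nat.descFactorial_mul_descFactorial (n := r) (Nat.le_add_right (m 1) (m 0))
    rw [Nat.add_sub_cancel_left, ht] at hfac
    have hit (i : Fin 2) (k : ℕ) (c : ℂ) (h : MvPolynomial (Fin 2) ℂ) :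
        (fun h => pderiv i h)^[k] (C c * h) = C c * (fun h => pderiv i h)^[k] h := by
      induction k with
      | zero => rfl
      | succ k ih => simp only [Function.iterate_succ_apply', ih, pderiv_C_mul]
    rw [diffOp_monomial, iterate_pderiv_linForm_pow, hit, iterate_pderiv_linForm_pow,
      Nat.sub_sub, ht, ← hfac, eval_monomial, Finsupp.prod_fintype _ _ (by simp),
      Fin.prod_univ_two, smul_eq_C_mul]
    simp only [Nat.cast_mul, C_mul]
    ring
  rw [φ.as_sum]
  simp only [map_sum, LinearMap.sum_apply, Finset.mul_sum, Finset.sum_mul]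
  refine Finset.sum_congr rfl fun m hm => hmon m _ ?_
  by_contra hd
  exact mem_support_iff.1 hm (hφ.coeff_eq_zero hd)

theorem exists_iterate_pderiv_mul_linForm_pow (i : Fin 2) (p q : ℂ) (k r : ℕ) {d : ℕ}
    {g : MvPolynomial (Fin 2) ℂ} (hg : g.IsHomogeneous d) :
    ∃ h, h.IsHomogeneous d ∧
      (fun h => pderiv i h)^[k] (g * linForm p q ^ (r + k)) = h * linForm p q ^ r := by
  have step (r : ℕ) {g : MvPolynomial (Fin 2) ℂ} (hg : g.IsHomogeneous d) :
      ∃ h, h.IsHomogeneous d ∧ pderiv i (g * linForm p q ^ (r + 1)) = h * linForm p q ^ r := by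
    obtain ⟨c, hc⟩ : ∃ c, pderiv i (linForm p q) = C c := by
      fin_cases i
      · exact ⟨p, by simp [linForm]⟩
      · exact ⟨q, by simp [linForm]⟩
    refine ⟨pderiv i g * linForm p q + C ((r + 1 : ℕ) * c) * g, .add ?_ (hg.C_mul _), ?_⟩
    · rcases Nat.eq_zero_or_pos d with rfl | hd
      · obtain ⟨a, rfl⟩ : ∃ a, g = C a :=
          ⟨_, totalDegree_eq_zero_iff_eq_C.1 ((totalDegree_zero_iff_isHomogeneous _).2 hg)⟩
        rw [pderiv_C, zero_mul]
        exact isHomogeneous_zero ..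
      · convert hg.pderiv.mul (isHomogeneous_linForm p q) using 1
        omega
    · rw [pderiv_mul, pderiv_pow, hc, C_mul, map_natCast, Nat.add_sub_cancel]
      ring
  induction k generalizing r with
  | zero => exact ⟨g, hg, rfl⟩
  | succ k ih =>
    obtain ⟨h, hh, heq⟩ := ih (r + 1)
    obtain ⟨h', hh', heq'⟩ := step r hh
    refine ⟨h', hh', ?_⟩
    rw [Function.iterate_succ_apply', show r + (k + 1) = r + 1 + k by ring, heq]
    exact heq'

theorem mem_span_monomials_of_isHomogeneous {d : ℕ} {g : MvPolynomial (Fin 2) ℂ}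
    (hg : g.IsHomogeneous d) :
    g ∈ Submodule.span ℂ (Set.range fun a : Fin (d + 1) =>
      (X 0 ^ (a : ℕ) * X 1 ^ (d - a) : MvPolynomial (Fin 2) ℂ)) := by
  rw [g.as_sum]
  refine Submodule.sum_mem _ fun m hm => ?_
  have hd : m 0 + m 1 = d := by
    rw [← Fin.sum_univ_two, ← Finsupp.degree_eq_sum]
    by_contra h
    exact mem_support_iff.1 hm (hg.coeff_eq_zero h)
  rw [monomial_eq, Finsupp.prod_fintype _ _ (by simp), Fin.prod_univ_two, ← smul_eq_C_mul]
  refine Submodule.smul_mem _ _ (Submodule.subset_span ⟨⟨m 0, by omega⟩, ?_⟩)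
  simp only [← hd, Nat.add_sub_cancel_left]

theorem diffOp_mul_linForm_pow_mem_span (p q : ℂ) {d t r : ℕ} {φ g : MvPolynomial (Fin 2) ℂ}
    (hφ : φ.IsHomogeneous t) (hg : g.IsHomogeneous d) :
    diffOp φ (g * linForm p q ^ (r + t)) ∈ Submodule.span ℂ (Set.range fun a : Fin (d + 1) =>
      (X 0 ^ (a : ℕ) * X 1 ^ (d - a) * linForm p q ^ r : MvPolynomial (Fin 2) ℂ)) := by
  rw [φ.as_sum, map_sum, LinearMap.sum_apply]
  refine Submodule.sum_mem _ fun m hm => ?_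
  have ht : m 0 + m 1 = t := by
    rw [← Fin.sum_univ_two, ← Finsupp.degree_eq_sum]
    by_contra h
    exact mem_support_iff.1 hm (hφ.coeff_eq_zero h)
  obtain ⟨h, hh, heq⟩ := exists_iterate_pderiv_mul_linForm_pow 1 p q (m 1) (r + m 0) hg
  obtain ⟨h', hh', heq'⟩ := exists_iterate_pderiv_mul_linForm_pow 0 p q (m 0) r hh
  rw [diffOp_monomial, ← ht, ← add_assoc, heq, heq']
  refine Submodule.smul_mem _ _ ?_
  have := Submodule.mem_map_of_mem (f := LinearMap.mulRight ℂ (linForm p q ^ r))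
    (mem_span_monomials_of_isHomogeneous hh')
  rw [Submodule.map_span, ← Set.range_comp] at this
  exact this

/-- The image of the catalecticant map in degree `e`. -/
noncomputable def catImage (e : ℕ) (f : MvPolynomial (Fin 2) ℂ) :
    Submodule ℂ (MvPolynomial (Fin 2) ℂ) :=
  (homogeneousSubmodule (Fin 2) ℂ e).map (diffOp.toLinearMap.flip f)

theorem span_contractOp_eq_catImage (e : ℕ) (f : MvPolynomial (Fin 2) ℂ) :
    Submodule.span ℂ {h | ∃ φ : MvPolynomial (Fin 2) ℂ, φ.IsHomogeneous e ∧ h = contractOp φ f} =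
      catImage e f := by
  rw [← (catImage e f).span_eq]
  congr 1
  ext h
  simp only [catImage, Set.mem_ofPred_eq, SetLike.mem_coe, Submodule.mem_map,
    mem_homogeneousSubmodule, ← diffOp_apply]
  exact exists_congr fun φ => and_congr_right fun _ => eq_comm

theorem catImage_le_span {n e m : ℕ} {p q : Fin m → ℂ} {g : Fin m → ℕ}
    {G : Fin m → MvPolynomial (Fin 2) ℂ} (he : 1 ≤ e) (hg : ∀ i, 1 ≤ g i) (hge : ∀ i, g i + e ≤ n + 1)
    (hG : ∀ i, (G i).IsHomogeneous (g i - 1)) :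
    catImage e (∑ i, G i * linForm (p i) (q i) ^ (n - g i + 1)) ≤
      Submodule.span ℂ (Set.range fun x : Σ i, Fin (g i) =>
        (X 0 ^ (x.2 : ℕ) * X 1 ^ (g x.1 - 1 - x.2) *
          linForm (p x.1) (q x.1) ^ (n + 1 - g x.1 - e) : MvPolynomial (Fin 2) ℂ)) := by
  rintro _ ⟨φ, hφ, rfl⟩
  rw [LinearMap.flip_apply, AlgHom.toLinearMap_apply, map_sum]
  refine Submodule.sum_mem _ fun i _ => ?_
  have h := hge i
  have h1 := hg i
  have := diffOp_mul_linForm_pow_mem_span (p i) (q i) (r := n + 1 - g i - e) hφ (hG i)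
  rw [show n + 1 - g i - e + e = n - g i + 1 by omega] at this
  refine Submodule.span_mono ?_ this
  rintro _ ⟨a, rfl⟩
  exact ⟨⟨i, ⟨a, by omega⟩⟩, rfl⟩

theorem det_ne_zero_of_not_proportional {p q p' q' : ℂ} (hpq : p ≠ 0 ∨ q ≠ 0)
    (h : ¬ Proportional (linForm p q) (linForm p' q')) : q * p' - p * q' ≠ 0 := by
  contrapose! h
  rw [sub_eq_zero] at h
  rcases hpq with hp | hq
  · refine ⟨p' / p, ?_⟩
    rw [linForm, linForm, smul_add, ← C_mul', ← C_mul', ← mul_assoc, ← mul_assoc, ← C_mul,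
      ← C_mul]
    congr 3
    · field_simp
    · field_simp
      linear_combination -h
  · refine ⟨q' / q, ?_⟩
    rw [linForm, linForm, smul_add, ← C_mul', ← C_mul', ← mul_assoc, ← mul_assoc, ← C_mul,
      ← C_mul]
    congr 3
    · field_simp
      linear_combination h
    · field_simp

theorem HasGADLength.pred {n m : ℕ} {f : MvPolynomial (Fin 2) ℂ}
    {L : Fin m → MvPolynomial (Fin 2) ℂ} {g : Fin m → ℕ} {G : Fin m → MvPolynomial (Fin 2) ℂ}
    (h : IsGAD n f m L g G) {i : Fin m} (hi : g i ≤ n) {H : MvPolynomial (Fin 2) ℂ}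
    (hH : H.IsHomogeneous (g i - 1 - 1)) (hH0 : g i - 1 = 0 → H = 0) (hGH : G i = H * L i) :
    HasGADLength n f (∑ j, g j - 1) := by
  obtain ⟨hL, hLL, hg, hG, hf⟩ := h
  have hgi := hg i
  by_cases h1 : g i = 1
  · obtain ⟨m, rfl⟩ : ∃ k, m = k + 1 := ⟨m - 1, by have := i.pos; omega⟩
    refine ⟨m, L ∘ i.succAbove, g ∘ i.succAbove, G ∘ i.succAbove, ⟨fun _ => hL _,
      fun _ _ hjk => hLL _ _ (i.succAbove_right_injective.ne hjk), fun _ => hg _, fun _ => hG _,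
      ?_⟩, ?_⟩
    · rw [hf, Fin.sum_univ_succAbove _ i, hGH, hH0 (by omega)]
      simp
    · rw [Fin.sum_univ_succAbove _ i, h1]
      simp
  · refine ⟨m, L, Function.update g i (g i - 1), Function.update G i H, ⟨hL, hLL, fun j => ?_,
      fun j => ?_, ?_⟩, ?_⟩
    · rcases eq_or_ne j i with rfl | hj
      · rw [Function.update_self]
        omega
      · rw [Function.update_of_ne hj]
        exact hg j
    · rcases eq_or_ne j i with rfl | hj
      · rwa [Function.update_self, Function.update_self]
      · rw [Function.update_of_ne hj, Function.update_of_ne hj]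
        exact hG j
    · rw [hf]
      refine Finset.sum_congr rfl fun j _ => ?_
      rcases eq_or_ne j i with rfl | hj
      · rw [Function.update_self, Function.update_self, hGH, mul_assoc, ← pow_succ']
        congr 2
        omega
      · rw [Function.update_of_ne hj, Function.update_of_ne hj]
    · rw [Finset.sum_update_of_mem (Finset.mem_univ i), Finset.sdiff_singleton_eq_erase,
        ← Finset.add_sum_erase _ g (Finset.mem_univ i)]
      omega

theorem sum_le_finrank_catImage {n e m : ℕ} {p q : Fin m → ℂ} {g : Fin m → ℕ}
    {G : Fin m → MvPolynomial (Fin 2) ℂ} (hpq : ∀ i, p i ≠ 0 ∨ q i ≠ 0)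
    (hdet : ∀ i j, i ≠ j → q i * p j - p i * q j ≠ 0) (hg : ∀ i, 1 ≤ g i)
    (hG : ∀ i, (G i).IsHomogeneous (g i - 1))
    (hG0 : ∀ i, diffOp (linForm (q i) (-p i) ^ (g i - 1)) (G i) ≠ 0)
    (hge : ∑ i, g i ≤ e) (hen : 2 * e ≤ n + 1)
    [Module.Finite ℂ (catImage e (∑ i, G i * linForm (p i) (q i) ^ (n - g i + 1)))] :
    ∑ i, g i ≤
      Module.finrank ℂ (catImage e (∑ i, G i * linForm (p i) (q i) ^ (n - g i + 1))) := by
  have hQ (i : Fin m) : ∃ u w : ℂ, u * p i + w * q i = 1 := by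
    rcases hpq i with h | h
    · exact ⟨(p i)⁻¹, 0, by simp [h]⟩
    · exact ⟨0, (q i)⁻¹, by simp [h]⟩
  choose u w huw using hQ
  set F : Fin m → MvPolynomial (Fin 2) ℂ := fun i => G i * linForm (p i) (q i) ^ (n - g i + 1)
    with hF
  set N : Fin m → MvPolynomial (Fin 2) ℂ := fun i => linForm (q i) (-p i) with hN
  set P : Fin m → MvPolynomial (Fin 2) ℂ := fun i => ∏ j ∈ Finset.univ.erase i, N j ^ g j with hP
  set t : Fin m → ℕ := fun i => ∑ j ∈ Finset.univ.erase i, g j with ht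
  have hts (i : Fin m) : g i + t i = ∑ j, g j := Finset.add_sum_erase _ g (Finset.mem_univ i)
  have hNhom (i : Fin m) (k : ℕ) : (N i ^ k).IsHomogeneous k := by
    simpa using (isHomogeneous_linForm (q i) (-p i)).pow k
  have hQhom (i : Fin m) (k : ℕ) : (linForm (u i) (w i) ^ k).IsHomogeneous k := by
    simpa using (isHomogeneous_linForm (u i) (w i)).pow k
  have hPhom (i : Fin m) : (P i).IsHomogeneous (t i) :=
    IsHomogeneous.prod _ _ _ fun j _ => hNhom j (g j)
  have hkill (i : Fin m) {ψ : MvPolynomial (Fin 2) ℂ} (h : N i ^ g i ∣ ψ) :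
      diffOp ψ (F i) = 0 := by
    obtain ⟨χ, rfl⟩ := h
    rw [mul_comm, diffOp_mul, diffOp_linForm_pow_mul_pow,
      diffOp_linForm_pow_eq_zero _ _ (hG i) (by have := hg i; omega), zero_mul, map_zero]
  have hdvdP {i j : Fin m} (h : j ≠ i) : N j ^ g j ∣ P i :=
    Finset.dvd_prod_of_mem (fun j => N j ^ g j) (by simp [h])
  set φ : (Σ i, Fin (g i)) → MvPolynomial (Fin 2) ℂ := fun x =>
    N x.1 ^ (x.2 : ℕ) * P x.1 * linForm (u x.1) (w x.1) ^ (e - t x.1 - x.2) with hφ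
  have hφhom (x : Σ i, Fin (g i)) : (φ x).IsHomogeneous e := by
    convert ((hNhom x.1 x.2).mul (hPhom x.1)).mul (hQhom x.1 (e - t x.1 - x.2)) using 1
    have := hts x.1
    have := x.2.2
    omega
  set A : (Σ i, Fin (g i)) → MvPolynomial (Fin 2) ℂ := fun x =>
    N x.1 ^ (g x.1 - 1 - x.2) * P x.1 with hA
  have hdvdA {i : Fin m} {x : Σ i, Fin (g i)} (h : i ≠ x.1) : N i ^ g i ∣ A x :=
    (hdvdP h).mul_left _
  have hdvdφ {i : Fin m} {x : Σ i, Fin (g i)} (h : i ≠ x.1) : N i ^ g i ∣ φ x :=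
    ((hdvdP h).mul_left _).mul_right _
  have hne {x y : Σ i, Fin (g i)} (h : x.1 ≠ y.1) : diffOp (A x * φ y) (∑ i, F i) = 0 := by
    rw [map_sum]
    refine Finset.sum_eq_zero fun l _ => hkill l ?_
    by_cases hl : l = x.1
    · exact (hdvdφ (hl ▸ h)).mul_left _
    · exact (hdvdA hl).mul_right _
  have heq {x y : Σ i, Fin (g i)} :
      diffOp (A x * φ y) (∑ i, F i) = diffOp (A x * φ y) (F x.1) := by
    rw [map_sum]
    exact Finset.sum_eq_single _ (fun l _ hl => hkill l ((hdvdA hl).mul_right _)) (by simp)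
  have hlt {i : Fin m} {k k' : Fin (g i)} (h : k < k') :
      diffOp (A ⟨i, k⟩ * φ ⟨i, k'⟩) (∑ i, F i) = 0 := by
    rw [heq]
    refine hkill i ((pow_dvd_pow (N i) (n := g i - 1 - k + k') ?_).trans ?_)
    · have : (k : ℕ) < k' := h
      have := k'.2
      omega
    · rw [pow_add]
      exact mul_dvd_mul (dvd_mul_right _ _) ((dvd_mul_right _ _).mul_right _)
  have hdiag (x : Σ i, Fin (g i)) : diffOp (A x * φ x) (∑ i, F i) ≠ 0 := by
    obtain ⟨i, k⟩ := x
    have hs := hts i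
    have hk := k.2
    obtain ⟨c, hc⟩ := exists_diffOp_linForm_pow_eq_C (q i) (-p i) (hG i)
    have hc0 : c ≠ 0 := by
      rintro rfl
      exact hG0 i (by rw [hc, C_0])
    set ψ := P i * P i * linForm (u i) (w i) ^ (e - t i - k) with hψ
    have hψhom : ψ.IsHomogeneous (t i + t i + (e - t i - k)) :=
      ((hPhom i).mul (hPhom i)).mul (hQhom i _)
    have hsplit : A ⟨i, k⟩ * φ ⟨i, k⟩ = ψ * N i ^ (g i - 1) := by
      conv_rhs => rw [show g i - 1 = (g i - 1 - k) + k by omega, pow_add]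
      simp only [hA, hφ, hψ]
      ring
    have heval : eval ![p i, q i] ψ ≠ 0 := by
      have hPe : eval ![p i, q i] (P i) ≠ 0 := by
        rw [hP, map_prod]
        refine Finset.prod_ne_zero_iff.2 fun j hj => ?_
        rw [map_pow]
        refine pow_ne_zero _ ?_
        simpa [hN, linForm, sub_eq_add_neg] using hdet j i (Finset.ne_of_mem_erase hj)
      have hQe : eval ![p i, q i] (linForm (u i) (w i)) = 1 := by
        simpa [linForm] using huw i
      rw [hψ, map_mul, map_mul, map_pow, hQe, one_pow, mul_one]
      exact mul_ne_zero hPe hPe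
    have hL0 : linForm (p i) (q i) ≠ 0 := by
      intro h0
      have := diffOp_linForm_linForm (u i) (w i) (p i) (q i)
      rw [h0, map_zero, huw, C_1] at this
      exact zero_ne_one this
    have hpow := diffOp_linForm_pow_right ![p i, q i] hψhom (n - g i + 1)
    simp only [Matrix.cons_val_zero, Matrix.cons_val_one] at hpow
    rw [heq, hsplit, diffOp_mul, diffOp_linForm_pow_mul_pow, hc, ← smul_eq_C_mul, map_smul, hpow]
    refine smul_ne_zero hc0 (mul_ne_zero ?_ (pow_ne_zero _ hL0))
    rw [Ne, C_eq_zero]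
    refine mul_ne_zero (Nat.cast_ne_zero.2 ?_) heval
    rw [Ne, Nat.descFactorial_eq_zero_iff_lt]
    omega
  have hli : LinearIndependent ℂ fun x => (⟨diffOp (φ x) (∑ i, F i), φ x, hφhom x, rfl⟩ :
      catImage e (∑ i, F i)) := by
    rw [Fintype.linearIndependent_iff]
    intro a ha
    replace ha : ∑ x, a x • diffOp (φ x) (∑ i, F i) = 0 := by
      simpa using congrArg Subtype.val ha
    have hak (i : Fin m) (k : ℕ) (hk : k < g i) : a ⟨i, k, hk⟩ = 0 := by
      induction k using Nat.strong_induction_on with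
      | _ k ih =>
        have h := congrArg (diffOp (A ⟨i, k, hk⟩)) ha
        rw [map_sum, map_zero, Finset.sum_eq_single ⟨i, k, hk⟩ _ (by simp), map_smul,
          ← diffOp_mul] at h
        · exact (smul_eq_zero.1 h).resolve_right (hdiag _)
        · rintro ⟨j, l, hl⟩ - hx
          rw [map_smul, ← diffOp_mul]
          rcases eq_or_ne i j with rfl | hij
          · rcases lt_trichotomy l k with hlk | rfl | hlk
            · rw [ih l hlk, zero_smul]
            · exact absurd rfl hx
            · rw [hlt (Fin.mk_lt_mk.2 hlk), smul_zero]
          · rw [hne hij, smul_zero]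
    exact fun x => hak x.1 x.2 x.2.2
  simpa using hli.fintype_card_le_finrank

theorem rank_catalecticant_of_length (n e s : ℕ)
    (f : MvPolynomial (Fin 2) ℂ) (hf : f.IsHomogeneous n)
    (hlen : IsLeast {l | HasGADLength n f l} s)
    (hs1 : 1 ≤ s) (hse : s ≤ e) (hen : 2 * e ≤ n + 1) :
    Module.finrank ℂ
      ↥(Submodule.span ℂ {h : MvPolynomial (Fin 2) ℂ |
        ∃ φ : MvPolynomial (Fin 2) ℂ, φ.IsHomogeneous e ∧ h = contractOp φ f}) = s := by
  obtain ⟨⟨m, L, g, G, hgad, hs⟩, hmin⟩ := hlen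
  obtain ⟨hL, hLL, hg, hG, hfG⟩ := id hgad
  choose p q hpq using fun i => exists_eq_linForm (hL i).2
  obtain rfl : L = fun i => linForm (p i) (q i) := funext hpq
  have hne (i : Fin m) : p i ≠ 0 ∨ q i ≠ 0 := by
    by_contra! h
    exact (hL i).1 (by simp [h.1, h.2, linForm])
  have hgs (i : Fin m) : g i ≤ s := hs ▸ Finset.single_le_sum (fun _ _ => Nat.zero_le _)
    (Finset.mem_univ i)
  have hG0 (i : Fin m) : diffOp (linForm (q i) (-p i) ^ (g i - 1)) (G i) ≠ 0 := by
    intro h0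
    obtain ⟨H, hH, hH0, hGH⟩ := exists_eq_mul_linForm (hne i) _ (hG i) h0
    have := hmin (HasGADLength.pred hgad (by have := hgs i; omega) hH hH0 hGH)
    omega
  have hle := catImage_le_span (n := n) (e := e) (p := p) (q := q) (hs1.trans hse) hg
    (fun i => by have := hgs i; omega) hG
  rw [span_contractOp_eq_catImage, hfG]
  have hfin := FiniteDimensional.span_of_finite ℂ (Set.finite_range fun x : Σ i, Fin (g i) =>
    (X 0 ^ (x.2 : ℕ) * X 1 ^ (g x.1 - 1 - x.2) *
      linForm (p x.1) (q x.1) ^ (n + 1 - g x.1 - e) : MvPolynomial (Fin 2) ℂ))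
  have := Submodule.finiteDimensional_of_le hle
  refine le_antisymm ?_ ?_
  · refine (Submodule.finrank_mono hle).trans ((finrank_range_le_card _).trans ?_)
    simp [hs]
  · rw [← hs]
    exact sum_le_finrank_catImage hne (fun i j hij => det_ne_zero_of_not_proportional (hne i)
      (hLL i j hij)) hg hG hG0 (hs.trans_le hse) hen
end
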